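/- Consider the scalar singularly perturbed impulsive equation μ z' = −z − z³ with impulse condition μ Δz|_{t=θ_i} = μ z^{1/3} + sin μ + 0.1 μ at the moments θ_i = i/3, i = 1,…,10, on the interval [0,T] with T = 4, where z^{1/3} denotes the real (sign-preserving) cube root, and with initial value z(0,μ) = 0.6. Then for all sufficiently small μ > 0 the solution z(t,μ) exists on [0,T] and satisfies: (i) lim_{μ→0+} z(t,μ) = 0 for every t ∈ ⋃_{i=0}^{9} (θ_i, θ_{i+1}] ∪ (θ_{10}, T], where θ_0 = 0; and (ii) lim_{μ→0+} z(θ_i+,μ) = 1.1 for each i = 1,…,10, so that the convergence is nonuniform near t = 0 and near each θ_i, i.e. multi-layers occur. -/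

import Mathlib

open Filter Topology Set

noncomputable section

/-- The real (sign-preserving) cube root. -/
def cbrt (x : ℝ) : ℝ := Real.sign x * |x| ^ ((1:ℝ)/3)

/-- `z` is a solution on `[0,T]` of the scalar singularly perturbed impulsive
problem `μ z' = G(z)`, `μ Δz|_{t=θ i} = I(z,μ)` (`i = 1,…,p`), `z(0,μ) = z0`. -/
def IsScalarImpSol (T : ℝ) (p : ℕ) (θ : ℕ → ℝ)
    (G : ℝ → ℝ) (I : ℝ → ℝ → ℝ)
    (μ : ℝ) (z0 : ℝ) (z : ℝ → ℝ) : Prop :=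
  z 0 = z0 ∧
  (∀ t ∈ Icc (0:ℝ) T, (∀ i ∈ Finset.Icc 1 p, t ≠ θ i) →
      ContinuousWithinAt z (Icc (0:ℝ) T) t) ∧
  (∀ i ∈ Finset.Icc 1 p, Tendsto z (𝓝[<] (θ i)) (𝓝 (z (θ i)))) ∧
  (∀ t ∈ Icc (0:ℝ) T, (∀ i ∈ Finset.Icc 1 p, t ≠ θ i) →
      HasDerivWithinAt z ((1/μ) * G (z t)) (Icc (0:ℝ) T \ (θ '' Icc 1 p)) t) ∧
  (∀ i ∈ Finset.Icc 1 p,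
      Tendsto z (𝓝[>] (θ i)) (𝓝 (z (θ i) + (1/μ) * I (z (θ i)) μ)))

/-- The solution of `y' = -y - y³`, `y(0) = a`, for nonnegative times. -/
def cubicFlow (a s : ℝ) : ℝ :=
  a * Real.exp (-s) / √(1 + a ^ 2 * (1 - Real.exp (-s) ^ 2))

theorem cubicFlow_zero (a : ℝ) : cubicFlow a 0 = a := by
  simp [cubicFlow]

theorem hasDerivAt_cubicFlow (a : ℝ) {s : ℝ} (hs : 0 ≤ s) :
    HasDerivAt (cubicFlow a) (-cubicFlow a s - cubicFlow a s ^ 3) s := by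
  have hE : HasDerivAt (fun s : ℝ => Real.exp (-s)) (-Real.exp (-s)) s := by
    simpa using (hasDerivAt_neg s).exp
  have hE1 : Real.exp (-s) ≤ 1 := Real.exp_le_one_iff.2 (by linarith)
  have hE0 := Real.exp_pos (-s)
  have hD : 0 < 1 + a ^ 2 * (1 - Real.exp (-s) ^ 2) := by
    have : 0 ≤ 1 - Real.exp (-s) ^ 2 := by nlinarith
    positivity
  have hS := (((hE.pow 2).const_sub 1).const_mul (a ^ 2)).const_add 1 |>.sqrt hD.ne'
  have hq := (hE.const_mul a).div hS (Real.sqrt_pos.2 hD).ne'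
  refine hq.congr_deriv ?_
  have hr := Real.sqrt_pos.2 hD
  have hr2 := Real.sq_sqrt hD.le
  simp only [cubicFlow, Pi.pow_apply]
  generalize √(1 + a ^ 2 * (1 - Real.exp (-s) ^ 2)) = r at *
  generalize Real.exp (-s) = E at *
  field_simp
  rw [hr2]
  ring

theorem hasDerivAt_cubicFlow_rescaled (a c : ℝ) {μ t : ℝ} (hμ : 0 < μ) (ht : c ≤ t) :
    HasDerivAt (fun t => cubicFlow a ((t - c) / μ))
      ((1 / μ) * (-cubicFlow a ((t - c) / μ) - cubicFlow a ((t - c) / μ) ^ 3)) t := by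
  have h1 : HasDerivAt (fun t : ℝ => (t - c) / μ) (1 / μ) t :=
    ((hasDerivAt_id t).sub_const c).div_const μ
  have h2 := (hasDerivAt_cubicFlow a (div_nonneg (sub_nonneg.2 ht) hμ.le)).comp t h1
  exact h2.congr_deriv (by ring)

theorem abs_le_exp_of_hasDerivAt {z : ℝ → ℝ} {a b μ L t : ℝ} (hμ : 0 < μ)
    (hz : ∀ t ∈ Ioo a b, HasDerivAt z ((1 / μ) * (-z t - z t ^ 3)) t)
    (ha : Tendsto z (𝓝[>] a) (𝓝 L)) (ht : t ∈ Ioo a b) :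
    |z t| ≤ |L| * Real.exp (-((t - a) / μ)) := by
  set u : ℝ → ℝ := fun t => z t ^ 2 * Real.exp ((t - a) / μ) ^ 2 with hu
  have hder : ∀ t ∈ Ioo a b,
      HasDerivAt u (-(2 / μ) * z t ^ 4 * Real.exp ((t - a) / μ) ^ 2) t := by
    intro t ht
    have hE : HasDerivAt (fun t => Real.exp ((t - a) / μ))
        (Real.exp ((t - a) / μ) * (1 / μ)) t :=
      (((hasDerivAt_id t).sub_const a).div_const μ).exp
    refine (((hz t ht).pow 2).mul (hE.pow 2)).congr_deriv ?_
    simp only [Pi.pow_apply]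
    ring
  have hanti : AntitoneOn u (Ioo a b) := by
    apply antitoneOn_of_deriv_nonpos (convex_Ioo a b)
    · exact fun x hx => (hder x hx).continuousAt.continuousWithinAt
    · rw [interior_Ioo]
      exact fun x hx => (hder x hx).differentiableAt.differentiableWithinAt
    · rw [interior_Ioo]
      intro x hx
      rw [(hder x hx).deriv]
      have : 0 ≤ (2 / μ) * z x ^ 4 * Real.exp ((x - a) / μ) ^ 2 := by positivity
      linarith
  have hlim : Tendsto u (𝓝[>] a) (𝓝 (L ^ 2)) := by
    have hE : Tendsto (fun t => Real.exp ((t - a) / μ)) (𝓝[>] a) (𝓝 1) := by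
      have : ContinuousAt (fun t => Real.exp ((t - a) / μ)) a := by fun_prop
      simpa [ContinuousAt] using this.tendsto.mono_left nhdsWithin_le_nhds
    simpa using (ha.pow 2).mul (hE.pow 2)
  have hle : u t ≤ L ^ 2 := by
    refine ge_of_tendsto hlim ?_
    filter_upwards [Ioo_mem_nhdsGT ht.1] with s hs
    exact hanti ⟨hs.1, hs.2.trans ht.2⟩ ht hs.2.le
  have hle' : |z t| * Real.exp ((t - a) / μ) ≤ |L| := by
    refine abs_le_of_sq_le_sq' ?_ (abs_nonneg L) |>.2
    rw [mul_pow, sq_abs, sq_abs]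
    exact hle
  rwa [Real.exp_neg, ← div_eq_mul_inv, le_div_iff₀ (Real.exp_pos _)]

theorem abs_le_exp_of_hasDerivAt_of_tendsto_left {z : ℝ → ℝ} {a b μ L t : ℝ} (hμ : 0 < μ)
    (hz : ∀ t ∈ Ioo a b, HasDerivAt z ((1 / μ) * (-z t - z t ^ 3)) t)
    (ha : Tendsto z (𝓝[>] a) (𝓝 L)) (hb : Tendsto z (𝓝[<] b) (𝓝 (z b)))
    (ht : t ∈ Ioc a b) :
    |z t| ≤ |L| * Real.exp (-((t - a) / μ)) := by
  rcases ht.2.lt_or_eq with htb | rfl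
  · exact abs_le_exp_of_hasDerivAt hμ hz ha ⟨ht.1, htb⟩
  · have hE : Tendsto (fun s => |L| * Real.exp (-((s - a) / μ))) (𝓝[<] t)
        (𝓝 (|L| * Real.exp (-((t - a) / μ)))) := by
      have : ContinuousAt (fun s => |L| * Real.exp (-((s - a) / μ))) t := by fun_prop
      exact this.tendsto.mono_left nhdsWithin_le_nhds
    refine le_of_tendsto_of_tendsto hb.abs hE ?_
    filter_upwards [Ioo_mem_nhdsLT ht.1] with s hs
    exact abs_le_exp_of_hasDerivAt hμ hz ha hs

theorem tendsto_cbrt_zero : Tendsto cbrt (𝓝 0) (𝓝 0) := by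
  have h : Tendsto (fun x : ℝ => |x| ^ ((1 : ℝ) / 3)) (𝓝 0) (𝓝 0) := by
    have : ContinuousAt (fun x : ℝ => |x| ^ ((1 : ℝ) / 3)) 0 :=
      continuous_abs.continuousAt.rpow_const (Or.inr (by norm_num))
    simpa [ContinuousAt] using this.tendsto
  refine squeeze_zero_norm (fun x => ?_) h
  rw [cbrt, Real.norm_eq_abs, abs_mul, abs_of_nonneg (by positivity : 0 ≤ |x| ^ ((1 : ℝ) / 3))]
  refine mul_le_of_le_one_left (by positivity) ?_
  rcases Real.sign_apply_eq x with h | h | h <;> simp [h]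

theorem tendsto_jump_of_tendsto_zero {y : ℝ → ℝ} (hy : Tendsto y (𝓝[>] 0) (𝓝 0)) :
    Tendsto (fun μ => y μ + (1 / μ) * (μ * cbrt (y μ) + Real.sin μ + 0.1 * μ))
      (𝓝[>] (0 : ℝ)) (𝓝 1.1) := by
  have hsin : Tendsto (fun μ : ℝ => μ⁻¹ * Real.sin μ) (𝓝[>] 0) (𝓝 1) := by
    have := (hasDerivAt_iff_tendsto_slope_zero.1 (Real.hasDerivAt_sin 0)).mono_left
      (nhdsGT_le_nhdsNE (0 : ℝ))
    simpa using this
  have h := ((hy.add (tendsto_cbrt_zero.comp hy)).add hsin).add_const (0.1 : ℝ)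
  rw [show (0 : ℝ) + 0 + 1 + 0.1 = 1.1 by norm_num] at h
  refine h.congr' ?_
  filter_upwards [self_mem_nhdsWithin] with μ (hμ : 0 < μ)
  simp only [Function.comp_apply]
  field_simp
  ring

theorem tendsto_exp_neg_div_nhdsGT_zero {c : ℝ} (hc : 0 < c) :
    Tendsto (fun μ : ℝ => Real.exp (-(c / μ))) (𝓝[>] 0) (𝓝 0) := by
  refine Real.tendsto_exp_neg_atTop_nhds_zero.comp ?_
  simpa only [← div_eq_mul_inv] using tendsto_inv_nhdsGT_zero.const_mul_atTop hc

/-- Right end of the `k`-th interval of continuity, `k = 0, …, 10`. -/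
def layerEnd (k : ℕ) : ℝ := if k < 10 then ((k : ℝ) + 1) / 3 else 4

theorem layerEnd_of_lt {k : ℕ} (hk : k < 10) : layerEnd k = ((k : ℝ) + 1) / 3 := if_pos hk

theorem layerEnd_eq_succ_div {k : ℕ} (hk : k < 10) : layerEnd k = ((k + 1 : ℕ) : ℝ) / 3 := by
  rw [layerEnd_of_lt hk, Nat.cast_succ]

theorem layerEnd_ten : layerEnd 10 = 4 := if_neg (lt_irrefl 10)

theorem lt_layerEnd {k : ℕ} (hk : k ≤ 10) : (k : ℝ) / 3 < layerEnd k := by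
  rcases hk.lt_or_eq with h | rfl
  · rw [layerEnd_of_lt h]; linarith
  · rw [layerEnd_ten]; norm_num

theorem layerEnd_le {k : ℕ} (hk : k ≤ 10) : layerEnd k ≤ 4 := by
  rcases hk.lt_or_eq with h | rfl
  · rw [layerEnd_of_lt h]
    have : (k : ℝ) ≤ 10 := by exact_mod_cast hk
    linarith
  · rw [layerEnd_ten]

theorem ne_impulse_of_mem_Ioo {k : ℕ} (hk : k ≤ 10) {t : ℝ}
    (ht : t ∈ Ioo ((k : ℝ) / 3) (layerEnd k)) {i : ℕ} (hi : i ∈ Finset.Icc 1 10) :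
    t ≠ (i : ℝ) / 3 := by
  rintro rfl
  obtain ⟨h1, h2⟩ := ht
  rw [Finset.mem_Icc] at hi
  have hki : k < i := by
    have : (k : ℝ) < i := by linarith
    exact_mod_cast this
  have hk' : k < 10 := by omega
  rw [layerEnd_of_lt hk'] at h2
  have : (i : ℝ) < k + 1 := by linarith
  have : i < k + 1 := by exact_mod_cast this
  omega

theorem IsScalarImpSol.abs_le_exp {I : ℝ → ℝ → ℝ} {μ z0 L t : ℝ} {z : ℝ → ℝ} {k : ℕ}
    (hμ : 0 < μ)
    (hz : IsScalarImpSol 4 10 (fun i => (i : ℝ) / 3) (fun z => -z - z ^ 3) I μ z0 z)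
    (hk : k ≤ 10) (hL : Tendsto z (𝓝[>] ((k : ℝ) / 3)) (𝓝 L))
    (ht : t ∈ Ioc ((k : ℝ) / 3) (layerEnd k)) :
    |z t| ≤ |L| * Real.exp (-((t - (k : ℝ) / 3) / μ)) := by
  obtain ⟨-, hcont, hleft, hderiv, -⟩ := hz
  have hk0 : (0 : ℝ) ≤ (k : ℝ) / 3 := by positivity
  have hsub : Ioo ((k : ℝ) / 3) (layerEnd k) ⊆ Icc (0 : ℝ) 4 := fun s hs =>
    ⟨hk0.trans hs.1.le, hs.2.le.trans (layerEnd_le hk)⟩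
  refine abs_le_exp_of_hasDerivAt_of_tendsto_left hμ (fun s hs => ?_) hL ?_ ht
  · refine (hderiv s (hsub hs) fun i hi => ne_impulse_of_mem_Ioo hk hs hi).hasDerivAt ?_
    filter_upwards [Ioo_mem_nhds hs.1 hs.2] with r hr
    refine ⟨hsub hr, ?_⟩
    rintro ⟨i, hi, hir⟩
    exact ne_impulse_of_mem_Ioo hk hr (Finset.mem_Icc.2 hi) hir.symm
  · rcases hk.lt_or_eq with h | rfl
    · have := hleft (k + 1) (Finset.mem_Icc.2 ⟨by omega, by omega⟩)
      rw [layerEnd_of_lt h]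
      simpa using this
    · rw [layerEnd_ten]
      have h4 : ∀ i ∈ Finset.Icc (1 : ℕ) 10, (4 : ℝ) ≠ (i : ℝ) / 3 := by
        intro i hi h
        have : (i : ℝ) ≤ 10 := by exact_mod_cast (Finset.mem_Icc.1 hi).2
        linarith
      refine (hcont 4 (by norm_num) h4).tendsto.mono_left ?_
      exact nhdsWithin_le_of_mem (mem_of_superset (Ioo_mem_nhdsLT (by norm_num : (0 : ℝ) < 4))
        Ioo_subset_Icc_self)

theorem IsScalarImpSol.tendsto_nhdsGT_zero {G : ℝ → ℝ} {I : ℝ → ℝ → ℝ} {μ z0 : ℝ} {z : ℝ → ℝ}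
    (hz : IsScalarImpSol 4 10 (fun i => (i : ℝ) / 3) G I μ z0 z) :
    Tendsto z (𝓝[>] 0) (𝓝 z0) := by
  obtain ⟨h0, hcont, -⟩ := hz
  have hne : ∀ i ∈ Finset.Icc (1 : ℕ) 10, (0 : ℝ) ≠ (i : ℝ) / 3 := by
    intro i hi
    have : (1 : ℝ) ≤ i := by exact_mod_cast (Finset.mem_Icc.1 hi).1
    exact ne_of_lt (by linarith)
  rw [← h0]
  refine (hcont 0 (by norm_num) hne).tendsto.mono_left ?_
  exact nhdsWithin_le_of_mem (mem_of_superset (Ioo_mem_nhdsGT (by norm_num : (0 : ℝ) < 4))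
    Ioo_subset_Icc_self)

section Existence

variable (J : ℝ → ℝ) (μ a : ℝ)

/-- Values from which the layers of the concatenated solution start; `J` is the jump map. -/
def layerStart : ℕ → ℝ
  | 0 => a
  | k + 1 => J (cubicFlow (layerStart k) (1 / 3 / μ))

/-- Index `k` of the interval of continuity `(k/3, (k+1)/3]` containing `t`, capped at `10`. -/
def layerIndex (t : ℝ) : ℕ := min 10 (⌈3 * t⌉₊ - 1)

/-- Concatenation of flow pieces, restarted at each impulse moment from `layerStart`. -/
def layerSol (t : ℝ) : ℝ :=
  cubicFlow (layerStart J μ a (layerIndex t)) ((t - (layerIndex t : ℝ) / 3) / μ)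

theorem layerIndex_eq {k : ℕ} (hk : k ≤ 10) {t : ℝ}
    (ht : t ∈ Ioc ((k : ℝ) / 3) (layerEnd k)) : layerIndex t = k := by
  obtain ⟨h1, h2⟩ := ht
  have hlt : k < ⌈3 * t⌉₊ := Nat.lt_ceil.2 (by linarith)
  unfold layerIndex
  rcases hk.lt_or_eq with h | rfl
  · rw [layerEnd_of_lt h] at h2
    have : ⌈3 * t⌉₊ ≤ k + 1 := Nat.ceil_le.2 (by push_cast; linarith)
    omega
  · omega

theorem layerIndex_of_nonpos {t : ℝ} (ht : t ≤ 0) : layerIndex t = 0 := by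
  have : ⌈3 * t⌉₊ = 0 := Nat.ceil_eq_zero.2 (by linarith)
  simp [layerIndex, this]

variable {J μ a}

theorem layerSol_eq {k : ℕ} (hk : k ≤ 10) {t : ℝ} (ht : t ∈ Ioc ((k : ℝ) / 3) (layerEnd k)) :
    layerSol J μ a t = cubicFlow (layerStart J μ a k) ((t - (k : ℝ) / 3) / μ) := by
  rw [layerSol, layerIndex_eq hk ht]

theorem layerSol_zero : layerSol J μ a 0 = a := by
  simp [layerSol, layerIndex_of_nonpos le_rfl, layerStart, cubicFlow_zero]

theorem exists_mem_Ioc_layer {t : ℝ} (ht : t ∈ Ioc (0 : ℝ) 4) :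
    ∃ k ≤ (10 : ℕ), t ∈ Ioc ((k : ℝ) / 3) (layerEnd k) := by
  rcases le_or_gt t (10 / 3) with h | h
  · have hpos : 0 < ⌈3 * t⌉₊ := Nat.ceil_pos.2 (by linarith [ht.1])
    have hle : ⌈3 * t⌉₊ ≤ 10 := Nat.ceil_le.2 (by push_cast; linarith)
    obtain ⟨k, hk⟩ : ∃ k, ⌈3 * t⌉₊ = k + 1 := ⟨⌈3 * t⌉₊ - 1, by omega⟩
    have h1 : (k : ℝ) < 3 * t := Nat.lt_ceil.1 (by omega)
    have h2 : 3 * t ≤ ((k + 1 : ℕ) : ℝ) := Nat.ceil_le.1 hk.le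
    push_cast at h2
    refine ⟨k, by omega, by linarith, ?_⟩
    rw [layerEnd_of_lt (by omega)]
    linarith
  · refine ⟨10, le_rfl, by push_cast; linarith, ?_⟩
    rw [layerEnd_ten]
    exact ht.2

theorem hasDerivWithinAt_layerSol (hμ : 0 < μ) {t : ℝ} (ht : t ∈ Icc (0 : ℝ) 4)
    (hne : ∀ i ∈ Finset.Icc (1 : ℕ) 10, t ≠ (i : ℝ) / 3) :
    HasDerivWithinAt (layerSol J μ a) ((1 / μ) * (-layerSol J μ a t - layerSol J μ a t ^ 3))
      (Icc 0 4) t := by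
  obtain ⟨k, hk, hkt, hev⟩ : ∃ k ≤ (10 : ℕ), (k : ℝ) / 3 ≤ t ∧ ∀ᶠ s in 𝓝[Icc 0 4] t,
      layerSol J μ a s = cubicFlow (layerStart J μ a k) ((s - (k : ℝ) / 3) / μ) := by
    rcases ht.1.eq_or_lt with rfl | h0
    · refine ⟨0, by omega, by simp, ?_⟩
      filter_upwards [self_mem_nhdsWithin,
        mem_nhdsWithin_of_mem_nhds (Iio_mem_nhds (by norm_num : (0 : ℝ) < 1 / 3))] with s hs hs'
      rcases hs.1.eq_or_lt with rfl | hs0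
      · simp [layerSol_zero, layerStart, cubicFlow_zero]
      · refine layerSol_eq (by omega) ⟨by simpa using hs0, ?_⟩
        rw [layerEnd_of_lt (by omega)]
        simpa using le_of_lt (mem_Iio.1 hs')
    · obtain ⟨k, hk, hkt⟩ := exists_mem_Ioc_layer ⟨h0, ht.2⟩
      refine ⟨k, hk, hkt.1.le, ?_⟩
      rcases hk.lt_or_eq with h | rfl
      · have hlt : t < layerEnd k := by
          refine hkt.2.lt_of_ne fun he => hne (k + 1) (Finset.mem_Icc.2 ⟨by omega, by omega⟩) ?_
          rw [he, layerEnd_of_lt h]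
          push_cast
          rfl
        filter_upwards [mem_nhdsWithin_of_mem_nhds (Ioo_mem_nhds hkt.1 hlt)] with s hs
        exact layerSol_eq hk ⟨hs.1, hs.2.le⟩
      · filter_upwards [self_mem_nhdsWithin,
          mem_nhdsWithin_of_mem_nhds (Ioi_mem_nhds hkt.1)] with s hs hs'
        exact layerSol_eq hk ⟨hs', by rw [layerEnd_ten]; exact hs.2⟩
  have heq := hev.self_of_nhdsWithin ht
  rw [heq]
  exact (hasDerivAt_cubicFlow_rescaled _ _ hμ hkt).hasDerivWithinAt.congr_of_eventuallyEq hev heq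

theorem isScalarImpSol_layerSol {I : ℝ → ℝ → ℝ} (hμ : 0 < μ) :
    IsScalarImpSol 4 10 (fun i => (i : ℝ) / 3) (fun z => -z - z ^ 3) I μ a
      (layerSol (fun x => x + (1 / μ) * I x μ) μ a) := by
  refine ⟨layerSol_zero, fun t ht hne => (hasDerivWithinAt_layerSol hμ ht hne).continuousWithinAt,
    fun i hi => ?_, fun t ht hne => (hasDerivWithinAt_layerSol hμ ht hne).mono sdiff_subset,
    fun i hi => ?_⟩
  · obtain ⟨h1, h2⟩ := Finset.mem_Icc.1 hi
    obtain ⟨k, rfl⟩ : ∃ k, i = k + 1 := ⟨i - 1, by omega⟩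
    have hend : layerEnd k = ((k + 1 : ℕ) : ℝ) / 3 := layerEnd_eq_succ_div (by omega)
    have hlt := lt_layerEnd (k := k) (by omega)
    simp only [← hend]
    rw [layerSol_eq (by omega) ⟨hlt, le_rfl⟩]
    refine ((hasDerivAt_cubicFlow_rescaled _ _ hμ hlt.le).continuousAt.tendsto.mono_left
      nhdsWithin_le_nhds).congr' ?_
    filter_upwards [Ioo_mem_nhdsLT hlt] with s hs
    exact (layerSol_eq (by omega) ⟨hs.1, hs.2.le⟩).symm
  · obtain ⟨h1, h2⟩ := Finset.mem_Icc.1 hi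
    have hval : layerSol (fun x => x + (1 / μ) * I x μ) μ a ((i : ℝ) / 3)
        + (1 / μ) * I (layerSol (fun x => x + (1 / μ) * I x μ) μ a ((i : ℝ) / 3)) μ
        = layerStart (fun x => x + (1 / μ) * I x μ) μ a i := by
      obtain ⟨k, rfl⟩ : ∃ k, i = k + 1 := ⟨i - 1, by omega⟩
      have hend : layerEnd k = ((k + 1 : ℕ) : ℝ) / 3 := layerEnd_eq_succ_div (by omega)
      rw [← hend, layerSol_eq (by omega) ⟨lt_layerEnd (by omega), le_rfl⟩, layerStart, hend,
        show ((k + 1 : ℕ) : ℝ) / 3 - (k : ℝ) / 3 = 1 / 3 by push_cast; ring]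
    simp only [hval]
    have hc := (hasDerivAt_cubicFlow_rescaled
      (layerStart (fun x => x + (1 / μ) * I x μ) μ a i) ((i : ℝ) / 3) hμ le_rfl).continuousAt.tendsto
    rw [sub_self, zero_div, cubicFlow_zero] at hc
    refine (hc.mono_left nhdsWithin_le_nhds).congr' ?_
    filter_upwards [Ioo_mem_nhdsGT (lt_layerEnd h2)] with s hs
    exact (layerSol_eq h2 ⟨hs.1, hs.2.le⟩).symm

end Existence

/-- Example 2 (multi-layers): the scalar equation `μ z' = −z − z³`,
`μ Δz|_{t=θ i} = μ z^{1/3} + sin μ + 0.1 μ`, `θ i = i/3`, `i = 1,…,10`,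
`T = 4`, `z(0,μ) = 0.6`.  For all sufficiently small `μ > 0` the solution
exists on `[0,4]`; it tends to `0` as `μ → 0+` for every
`t ∈ ⋃_{i=0}^{9} (θ_i, θ_{i+1}] ∪ (θ_{10}, 4]` (`θ_0 = 0`), while the right
limits at the impulse moments satisfy `z(θ_i +, μ) → 1.1`, so that
multi-layers occur near `t = 0` and near each `θ_i`. -/
theorem example_scalar_multi_layer :
    ∃ μ₀ > (0:ℝ),
      (∀ μ ∈ Ioc (0:ℝ) μ₀, ∃ z : ℝ → ℝ,
        IsScalarImpSol 4 10 (fun i => (i:ℝ)/3)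
          (fun z => -z - z^3)
          (fun z μ => μ * cbrt z + Real.sin μ + 0.1 * μ) μ 0.6 z) ∧
      ∀ Z : ℝ → ℝ → ℝ,
        (∀ μ ∈ Ioc (0:ℝ) μ₀,
          IsScalarImpSol 4 10 (fun i => (i:ℝ)/3)
            (fun z => -z - z^3)
            (fun z μ => μ * cbrt z + Real.sin μ + 0.1 * μ) μ 0.6 (Z μ)) →
        -- (i) pointwise convergence to the root 0 on the union of intervals
        (∀ t ∈ (⋃ i ∈ Finset.range 10, Set.Ioc ((i:ℝ)/3) (((i:ℝ)+1)/3)) ∪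
            Set.Ioc ((10:ℝ)/3) 4,
          Tendsto (fun μ => Z μ t) (𝓝[>] (0:ℝ)) (𝓝 0)) ∧
        -- (ii) the right limits z(θ_i +, μ) = z(θ_i,μ) + I(z(θ_i,μ),μ)/μ tend
        -- to 1.1: multi-layers appear after each impulse moment
        (∀ i ∈ Finset.Icc (1:ℕ) 10,
          Tendsto (fun μ => Z μ ((i:ℝ)/3)
              + (1/μ) * (μ * cbrt (Z μ ((i:ℝ)/3)) + Real.sin μ + 0.1 * μ))
            (𝓝[>] (0:ℝ)) (𝓝 1.1)) := by
  refine ⟨1, one_pos, fun μ hμ => ⟨_, isScalarImpSol_layerSol hμ.1⟩, fun Z hZ => ?_⟩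
  have hpos : ∀ᶠ μ in 𝓝[>] (0 : ℝ), μ ∈ Ioc (0 : ℝ) 1 := Ioc_mem_nhdsGT one_pos
  have decay : ∀ k ≤ (10 : ℕ), ∀ (R : ℝ → ℝ) (c : ℝ), Tendsto R (𝓝[>] 0) (𝓝 c) →
      (∀ μ ∈ Ioc (0 : ℝ) 1, Tendsto (Z μ) (𝓝[>] ((k : ℝ) / 3)) (𝓝 (R μ))) →
      ∀ t ∈ Ioc ((k : ℝ) / 3) (layerEnd k), Tendsto (fun μ => Z μ t) (𝓝[>] (0 : ℝ)) (𝓝 0) := by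
    intro k hk R c hR hlim t ht
    have hbound := hR.abs.mul (tendsto_exp_neg_div_nhdsGT_zero (sub_pos.2 ht.1))
    rw [mul_zero] at hbound
    refine squeeze_zero_norm' ?_ hbound
    filter_upwards [hpos] with μ hμ
    exact (hZ μ hμ).abs_le_exp hμ.1 hk (hlim μ hμ) ht
  have layer : ∀ k ≤ (10 : ℕ), ∀ t ∈ Ioc ((k : ℝ) / 3) (layerEnd k),
      Tendsto (fun μ => Z μ t) (𝓝[>] (0 : ℝ)) (𝓝 0) := by
    intro k
    induction k with
    | zero =>
      intro hk
      refine decay 0 hk _ _ (tendsto_const_nhds (x := (0.6 : ℝ))) fun μ hμ => ?_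
      simpa using (hZ μ hμ).tendsto_nhdsGT_zero
    | succ k ih =>
      intro hk
      have hend : layerEnd k = ((k + 1 : ℕ) : ℝ) / 3 := layerEnd_eq_succ_div (by omega)
      have h0 := ih (by omega) (layerEnd k) ⟨lt_layerEnd (by omega), le_rfl⟩
      rw [hend] at h0
      exact decay (k + 1) hk _ _ (tendsto_jump_of_tendsto_zero h0) fun μ hμ =>
        (hZ μ hμ).2.2.2.2 (k + 1) (Finset.mem_Icc.2 ⟨by omega, hk⟩)
  refine ⟨fun t ht => ?_, fun i hi => tendsto_jump_of_tendsto_zero ?_⟩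
  · rcases ht with ht | ht
    · simp only [mem_iUnion, Finset.mem_range] at ht
      obtain ⟨k, hk, ht⟩ := ht
      exact layer k hk.le t (by rwa [layerEnd_of_lt hk])
    · exact layer 10 le_rfl t (by rw [layerEnd_ten]; exact_mod_cast ht)
  · obtain ⟨h1, h2⟩ := Finset.mem_Icc.1 hi
    obtain ⟨k, rfl⟩ : ∃ k, i = k + 1 := ⟨i - 1, by omega⟩
    have hend : layerEnd k = ((k + 1 : ℕ) : ℝ) / 3 := layerEnd_eq_succ_div (by omega)
    rw [← hend]
    exact layer k (by omega) _ ⟨lt_layerEnd (by omega), le_rfl⟩
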